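/- arXiv:1608.05591 — 2 statements merged into one kernel-verified Lean document; each statement's English description precedes it below -/
import Mathlib

section
/- Let ω⁰ > 0 and set b⁰ := ω⁰/2 (so that (ω⁰)² = 4(b⁰)²). Then ω(t) = ω⁰/(4tω⁰+1) and b(t)² = (ω⁰)²/(4(4tω⁰+1)²) solve, on [0,∞), the system ∂ₜω = −16 b², ∂ₜ(b²) = −8 ω b², with ω(0) = ω⁰ and b(0)² = (b⁰)². In particular ω(t) → 0 and b(t)² → 0 as t → ∞, but t ↦ |b(t)| is not integrable on [0,∞). -/
open Filter MeasureTheory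

/-- Degenerate explicit solution `ω(t) = ω⁰/(4tω⁰+1)`. -/
noncomputable def w4 (w : ℝ) (t : ℝ) : ℝ := w / (4 * t * w + 1)

/-- Degenerate explicit solution `b(t)² = (ω⁰)²/(4(4tω⁰+1)²)`. -/
noncomputable def b4sq (w : ℝ) (t : ℝ) : ℝ := w ^ 2 / (4 * (4 * t * w + 1) ^ 2)

lemma b4sq_eq_sq (w t : ℝ) : b4sq w t = (w4 w t / 2) ^ 2 := by
  rw [b4sq, w4, div_div, div_pow]
  congr 1
  ring

lemma hasDerivAt_w4 {w t : ℝ} (h : 4 * t * w + 1 ≠ 0) :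
    HasDerivAt (w4 w) (-16 * b4sq w t) t := by
  have hd : HasDerivAt (fun s : ℝ => 4 * s * w + 1) (4 * w) t := by
    simpa using (((hasDerivAt_id t).const_mul 4).mul_const w).add_const 1
  refine ((hasDerivAt_const t w).div hd h).congr_deriv ?_
  rw [b4sq]
  field_simp
  ring

lemma hasDerivAt_b4sq {w t : ℝ} (h : 4 * t * w + 1 ≠ 0) :
    HasDerivAt (b4sq w) (-8 * w4 w t * b4sq w t) t := by
  rw [funext (b4sq_eq_sq w)]
  refine (((hasDerivAt_w4 h).div_const 2).pow 2).congr_deriv ?_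
  rw [b4sq_eq_sq]
  push_cast
  ring

lemma tendsto_w4_atTop {w : ℝ} (hw : 0 < w) : Tendsto (w4 w) atTop (nhds 0) := by
  have h : Tendsto (fun t : ℝ => 4 * t * w + 1) atTop atTop :=
    tendsto_atTop_add_const_right _ _
      ((tendsto_id.const_mul_atTop (by norm_num : (0 : ℝ) < 4)).atTop_mul_const hw)
  exact h.const_div_atTop w

lemma tendsto_b4sq_atTop {w : ℝ} (hw : 0 < w) : Tendsto (b4sq w) atTop (nhds 0) := by
  rw [funext (b4sq_eq_sq w)]
  simpa using ((tendsto_w4_atTop hw).div_const 2).pow 2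

lemma not_integrableOn_abs_sqrt_b4sq {w : ℝ} (hw : 0 < w) :
    ¬ IntegrableOn (fun t => |Real.sqrt (b4sq w t)|) (Set.Ici 0) := by
  intro h
  have h1 : IntegrableOn (fun t => |Real.sqrt (b4sq w t)|) (Set.Ioi 1) :=
    h.mono_set fun t ht => Set.mem_Ici.2 (zero_le_one.trans (Set.mem_Ioi.1 ht).le)
  refine not_integrableOn_Ioi_inv (a := 1) ?_
  refine (h1.const_mul (2 * (4 * w + 1) / w)).mono' measurable_inv.aestronglyMeasurable ?_
  filter_upwards [ae_restrict_mem measurableSet_Ioi] with t ht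
  have ht1 : 1 < t := ht
  have ht0 : 0 < t := one_pos.trans ht1
  have hD : 0 < 4 * t * w + 1 := by positivity
  have hpos : 0 ≤ w4 w t / 2 := by
    rw [w4]
    positivity
  rw [Real.norm_of_nonneg (inv_nonneg.2 ht0.le), b4sq_eq_sq, Real.sqrt_sq hpos,
    abs_of_nonneg hpos, w4]
  have heq : 2 * (4 * w + 1) / w * (w / (4 * t * w + 1) / 2) =
      (4 * w + 1) / (4 * t * w + 1) := by
    field_simp
  rw [heq, inv_eq_one_div, div_le_div_iff₀ ht0 hD]
  linarith

/-- Degenerate case `(ω⁰)² = 4(b⁰)²` (i.e. `b⁰ = ω⁰/2`): `ω(t) = ω⁰/(4tω⁰+1)` and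
`b(t)² = (ω⁰)²/(4(4tω⁰+1)²)` solve `∂ₜω = −16b²`, `∂ₜ(b²) = −8ωb²` on `[0,∞)` with
`ω(0) = ω⁰`, `b(0)² = (b⁰)²`; both tend to `0` at infinity but `t ↦ |b(t)|` is not
integrable on `[0,∞)`. -/
theorem stmt_4 (w : ℝ) (hw : 0 < w) :
    w4 w 0 = w ∧ b4sq w 0 = (w / 2) ^ 2 ∧
      (∀ t ∈ Set.Ici (0 : ℝ),
        HasDerivAt (w4 w) (-16 * b4sq w t) t ∧
          HasDerivAt (b4sq w) (-8 * w4 w t * b4sq w t) t) ∧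
      Tendsto (w4 w) atTop (nhds 0) ∧
      Tendsto (b4sq w) atTop (nhds 0) ∧
      ¬ IntegrableOn (fun t => |Real.sqrt (b4sq w t)|) (Set.Ici 0) := by
  have hD : ∀ t ∈ Set.Ici (0 : ℝ), 4 * t * w + 1 ≠ 0 := fun t ht => by
    have ht0 : 0 ≤ t := ht
    positivity
  have h0 : w4 w 0 = w := by simp [w4]
  exact ⟨h0, by rw [b4sq_eq_sq, h0],
    fun t ht => ⟨hasDerivAt_w4 (hD t ht), hasDerivAt_b4sq (hD t ht)⟩,
    tendsto_w4_atTop hw, tendsto_b4sq_atTop hw, not_integrableOn_abs_sqrt_b4sq hw⟩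
end

section
/- For any bounded operators X, Y on a separable Hilbert space h such that both XY and YX are trace class, tr(XY) = tr(YX). -/
open scoped InnerProductSpace
open Filter Topology ContinuousLinearMap

section TraceClass

variable {H ι : Type*} [NormedAddCommGroup H] [InnerProductSpace ℂ H]

/-- The diagonal sum of an operator in a Hilbert basis. -/
noncomputable def diagSum (e : HilbertBasis ι ℂ H) (A : H →L[ℂ] H) : ℂ :=
  ∑' k, ⟪(e k : H), A (e k)⟫_ℂ

/-- Hilbert–Schmidt operators, with respect to a given Hilbert basis. -/
def IsHilbertSchmidt (e : HilbertBasis ι ℂ H) (A : H →L[ℂ] H) : Prop :=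
  Summable fun k => ‖A (e k)‖ ^ 2

theorem HilbertBasis.hasSum_norm_inner_sq (e : HilbertBasis ι ℂ H) (x : H) :
    HasSum (fun j => ‖⟪(e j : H), x⟫_ℂ‖ ^ 2) (‖x‖ ^ 2) := by
  have h := (e.hasSum_inner_mul_inner x x).mapL Complex.reCLM
  simp only [Complex.reCLM_apply] at h
  convert h using 1
  · ext j
    rw [← inner_conj_symm x, Complex.conj_mul', ← Complex.ofReal_pow, Complex.ofReal_re]
  · exact (inner_self_eq_norm_sq (𝕜 := ℂ) x).symm

theorem isHilbertSchmidt_iff_summable_matrix (e : HilbertBasis ι ℂ H) (A : H →L[ℂ] H) :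
    IsHilbertSchmidt e A ↔
      Summable fun p : ι × ι => ‖⟪(e p.2 : H), A (e p.1)⟫_ℂ‖ ^ 2 := by
  rw [summable_prod_of_nonneg (fun _ => by positivity)]
  simp only [(e.hasSum_norm_inner_sq _).tsum_eq]
  exact ⟨fun h => ⟨fun k => (e.hasSum_norm_inner_sq _).summable, h⟩, fun h => h.2⟩

theorem IsHilbertSchmidt.mul_left {e : HilbertBasis ι ℂ H} {A : H →L[ℂ] H}
    (hA : IsHilbertSchmidt e A) (B : H →L[ℂ] H) : IsHilbertSchmidt e (B * A) := by
  refine Summable.of_nonneg_of_le (fun _ => by positivity) (fun k => ?_)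
    (Summable.mul_left (‖B‖ ^ 2) hA)
  rw [← mul_pow]
  exact pow_le_pow_left₀ (norm_nonneg _) (B.le_opNorm _) 2

theorem IsHilbertSchmidt.summable_mul {e : HilbertBasis ι ℂ H} {A B : H →L[ℂ] H}
    (hA : IsHilbertSchmidt e A) (hB : IsHilbertSchmidt e B) :
    Summable fun k => ‖A (e k)‖ * ‖B (e k)‖ := by
  refine Summable.of_nonneg_of_le (fun _ => by positivity) (fun k => ?_) (Summable.add hA hB)
  nlinarith [sq_nonneg (‖A (e k)‖ - ‖B (e k)‖), sq_nonneg (‖A (e k)‖), sq_nonneg (‖B (e k)‖)]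

variable [CompleteSpace H]

theorem IsHilbertSchmidt.star {e : HilbertBasis ι ℂ H} {A : H →L[ℂ] H}
    (hA : IsHilbertSchmidt e A) : IsHilbertSchmidt e (star A) := by
  rw [isHilbertSchmidt_iff_summable_matrix] at hA ⊢
  refine (hA.comp_injective Prod.swap_injective).congr fun p => ?_
  simp only [Function.comp, Prod.fst_swap, Prod.snd_swap]
  rw [star_eq_adjoint, adjoint_inner_right, norm_inner_symm]

theorem IsHilbertSchmidt.mul_right {e : HilbertBasis ι ℂ H} {A : H →L[ℂ] H}
    (hA : IsHilbertSchmidt e A) (B : H →L[ℂ] H) : IsHilbertSchmidt e (A * B) := by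
  simpa using (hA.star.mul_left (Star.star B)).star

theorem inner_mul_apply (A B : H →L[ℂ] H) (x y : H) :
    ⟪x, (A * B) y⟫_ℂ = ⟪(star A) x, B y⟫_ℂ := by
  rw [star_eq_adjoint, adjoint_inner_left]; rfl

theorem IsHilbertSchmidt.summable_diag {e : HilbertBasis ι ℂ H} {A B : H →L[ℂ] H}
    (hA : IsHilbertSchmidt e A) (hB : IsHilbertSchmidt e B) :
    Summable fun k => ⟪(e k : H), (A * B) (e k)⟫_ℂ := by
  refine Summable.of_norm_bounded (hA.star.summable_mul hB) fun k => ?_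
  rw [inner_mul_apply]
  exact norm_inner_le_norm _ _

theorem IsHilbertSchmidt.diagSum_mul_comm {e : HilbertBasis ι ℂ H} {A B : H →L[ℂ] H}
    (hA : IsHilbertSchmidt e A) (hB : IsHilbertSchmidt e B) :
    diagSum e (A * B) = diagSum e (B * A) := by
  have expand (A B : H →L[ℂ] H) (k : ι) : ⟪(e k : H), (A * B) (e k)⟫_ℂ =
      ∑' j, ⟪(e k : H), A (e j)⟫_ℂ * ⟪(e j : H), B (e k)⟫_ℂ := by
    rw [inner_mul_apply, ← e.tsum_inner_mul_inner]
    simp only [star_eq_adjoint, adjoint_inner_left]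
  have hs : Summable fun p : ι × ι =>
      ⟪(e p.1 : H), A (e p.2)⟫_ℂ * ⟪(e p.2 : H), B (e p.1)⟫_ℂ := by
    have h1 := ((isHilbertSchmidt_iff_summable_matrix e A).1 hA).comp_injective
      Prod.swap_injective
    have h2 := (isHilbertSchmidt_iff_summable_matrix e B).1 hB
    refine Summable.of_norm_bounded (h1.add h2) fun p => ?_
    simp only [Function.comp, Prod.fst_swap, Prod.snd_swap, norm_mul]
    nlinarith [sq_nonneg (‖⟪(e p.1 : H), A (e p.2)⟫_ℂ‖ - ‖⟪(e p.2 : H), B (e p.1)⟫_ℂ‖),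
      sq_nonneg ‖⟪(e p.1 : H), A (e p.2)⟫_ℂ‖, sq_nonneg ‖⟪(e p.2 : H), B (e p.1)⟫_ℂ‖]
  unfold diagSum
  simp only [expand]
  rw [← Summable.tsum_comm (f := fun k j =>
    ⟪(e k : H), A (e j)⟫_ℂ * ⟪(e j : H), B (e k)⟫_ℂ) hs]
  exact tsum_congr fun k => tsum_congr fun j => mul_comm _ _

/-- The trace of a product of two Hilbert–Schmidt operators commutes with a bounded factor. -/
theorem IsHilbertSchmidt.diagSum_mul_comm_bounded {e : HilbertBasis ι ℂ H} {A B : H →L[ℂ] H}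
    (hA : IsHilbertSchmidt e A) (hB : IsHilbertSchmidt e B) (C : H →L[ℂ] H) :
    diagSum e (C * (A * B)) = diagSum e (A * B * C) := by
  rw [← mul_assoc, (hA.mul_left C).diagSum_mul_comm hB, ← mul_assoc,
    (hB.mul_right C).diagSum_mul_comm hA, mul_assoc]

theorem IsHilbertSchmidt.tendsto_diagSum_zero {e : HilbertBasis ι ℂ H} {A B : H →L[ℂ] H}
    (hA : IsHilbertSchmidt e A) (hB : IsHilbertSchmidt e B) {D : ℕ → H →L[ℂ] H}
    (hD : ∀ n, ‖D n‖ ≤ 1) (hlim : Tendsto (fun n => ‖B * D n * A‖) atTop (𝓝 0)) :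
    Tendsto (fun n => diagSum e (B * D n * A)) atTop (𝓝 0) := by
  have h := tendsto_tsum_of_dominated_convergence (𝓕 := atTop)
    (f := fun n k => ⟪(e k : H), (B * D n * A) (e k)⟫_ℂ) (g := fun _ => (0 : ℂ))
    (hB.star.summable_mul hA) (fun k => ?_) (Eventually.of_forall fun n k => ?_)
  · simpa [diagSum] using h
  · refine squeeze_zero_norm (fun n => ?_) hlim
    refine (norm_inner_le_norm _ _).trans ?_
    rw [e.orthonormal.1 k, one_mul]
    exact (le_opNorm _ _).trans (by rw [e.orthonormal.1 k, mul_one])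
  · rw [mul_assoc, inner_mul_apply]
    refine (norm_inner_le_norm _ _).trans (mul_le_mul_of_nonneg_left ?_ (norm_nonneg _))
    exact ((D n).le_opNorm _).trans (mul_le_of_le_one_left (norm_nonneg _) (hD n))

theorem exists_eq_mul_of_norm_le {T P : H →L[ℂ] H} (h : ∀ x, ‖T x‖ ≤ ‖P x‖) :
    ∃ V : H →L[ℂ] H, T = V * P := by
  let K : Submodule ℂ H := P.range.topologicalClosure
  have : CompleteSpace K := (Submodule.isClosed_topologicalClosure _).completeSpace_coe
  let E : H →L[ℂ] K := P.codRestrict K fun x =>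
    Submodule.le_topologicalClosure _ (LinearMap.mem_range_self _ x)
  have hE : DenseRange E := by
    intro y
    rw [closure_subtype, ← Set.range_comp]
    exact y.2
  refine ⟨((T : H →ₗ[ℂ] H).extendOfNorm (E : H →ₗ[ℂ] K)).comp K.orthogonalProjectionOnto, ?_⟩
  ext x
  have h1 : K.orthogonalProjectionOnto (P x) = E x :=
    Submodule.orthogonalProjectionOnto_mem_subspace_eq_self (E x)
  change _ = (T : H →ₗ[ℂ] H).extendOfNorm (E : H →ₗ[ℂ] K) (K.orthogonalProjectionOnto (P x))
  rw [h1]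
  exact (LinearMap.extendOfNorm_eq (f := (T : H →ₗ[ℂ] H)) (e := (E : H →ₗ[ℂ] K)) hE
    ⟨1, fun x => (h x).trans (one_mul _).ge⟩ x).symm

/-- Polar factorization of a trace class operator through a Hilbert–Schmidt operator. -/
theorem exists_polar_factorization (e : HilbertBasis ι ℂ H) (T : H →L[ℂ] H)
    (hT : Summable fun k => (⟪(e k : H), cfc Real.sqrt (star T * T) (e k)⟫_ℂ).re) :
    ∃ V S : H →L[ℂ] H, T = V * S * S ∧ star S = S ∧ IsHilbertSchmidt e S ∧
      ∀ x, ‖S (S x)‖ = ‖T x‖ := by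
  have hsp : ∀ t ∈ spectrum ℝ (star T * T), 0 ≤ t := fun t ht =>
    spectrum_nonneg_of_nonneg (star_mul_self_nonneg T) ht
  set P := cfc Real.sqrt (star T * T) with hP
  set S := cfc (fun t => Real.sqrt (Real.sqrt t)) (star T * T) with hS
  have hPsa : star P = P := (cfc_predicate Real.sqrt (star T * T) : IsSelfAdjoint _)
  have hSsa : star S = S :=
    (cfc_predicate (fun t => Real.sqrt (Real.sqrt t)) (star T * T) : IsSelfAdjoint _)
  have hSS : S * S = P := by
    rw [hS, hP, ← cfc_mul _ _ _ (by fun_prop) (by fun_prop)]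
    exact cfc_congr fun t _ => Real.mul_self_sqrt (Real.sqrt_nonneg t)
  have hPP : P * P = star T * T := by
    rw [hP, ← cfc_mul _ _ _ (by fun_prop) (by fun_prop)]
    conv_rhs => rw [← cfc_id ℝ (star T * T)]
    exact cfc_congr fun t ht => Real.mul_self_sqrt (hsp t ht)
  have norm_sq (A : H →L[ℂ] H) (x : H) : ‖A x‖ ^ 2 = (⟪x, (star A * A) x⟫_ℂ).re := by
    rw [inner_mul_apply, star_star]
    exact (inner_self_eq_norm_sq (𝕜 := ℂ) (A x)).symm
  have hnorm (x : H) : ‖P x‖ = ‖T x‖ := by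
    rw [← sq_eq_sq₀ (norm_nonneg _) (norm_nonneg _), norm_sq, norm_sq, hPsa, hPP]
  obtain ⟨V, hV⟩ := exists_eq_mul_of_norm_le fun x => (hnorm x).ge
  refine ⟨V, S, by rw [mul_assoc, hSS, ← hV], hSsa, ?_, fun x => ?_⟩
  · unfold IsHilbertSchmidt
    simpa only [norm_sq, hSsa, hSS] using hT
  · rw [← hnorm, ← hSS]; rfl

/-- Tikhonov regularization: approximate generalized inverses of a bounded operator. -/
theorem exists_approx_inverse (X : H →L[ℂ] H) {ε : ℝ} (hε : 0 < ε) :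
    ∃ K : H →L[ℂ] H, ‖1 - X * K‖ ≤ 1 ∧ ‖1 - K * X‖ ≤ 1 ∧
      ‖(1 - X * K) * X‖ ^ 2 ≤ ε := by
  set Q : H →L[ℂ] H := X * star X + (ε : ℂ) • 1 with hQ
  have key (y : H) : (⟪Q y, y⟫_ℂ).re = ‖star X y‖ ^ 2 + ε * ‖y‖ ^ 2 := by
    have h1 : ⟪X (star X y), y⟫_ℂ = ⟪star X y, star X y⟫_ℂ := by
      rw [star_eq_adjoint, adjoint_inner_right]
    have h2 (z : H) : (⟪z, z⟫_ℂ).re = ‖z‖ ^ 2 := inner_self_eq_norm_sq (𝕜 := ℂ) z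
    have h3 : Q y = X (star X y) + (ε : ℂ) • y := rfl
    rw [h3, inner_add_left, inner_smul_left, h1, Complex.conj_ofReal, Complex.add_re,
      Complex.re_ofReal_mul, h2, h2]
  have hunit : IsUnit Q := by
    refine isUnit_of_forall_le_norm_inner_map Q (c := ⟨ε, hε.le⟩) hε fun x => ?_
    refine le_trans ?_ (Complex.re_le_norm _)
    rw [key]
    change ‖x‖ ^ 2 * ε ≤ _
    nlinarith [sq_nonneg ‖star X x‖]
  obtain ⟨R, hR⟩ := hunit.exists_right_inv
  have hQR (x : H) : Q (R x) = x := DFunLike.congr_fun hR x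
  have hXK : 1 - X * (star X * R) = (ε : ℂ) • R := by
    rw [← hR, hQ, add_mul, smul_mul_assoc, one_mul, mul_assoc, add_sub_cancel_left]
  have hnε : ‖(ε : ℂ)‖ = ε := by simp [abs_of_pos hε]
  refine ⟨star X * R, ?_, ?_, ?_⟩
  · rw [hXK]
    refine opNorm_le_bound _ zero_le_one fun x => ?_
    have h := key (R x)
    rw [hQR] at h
    have h2 := (Complex.re_le_norm _).trans (norm_inner_le_norm (𝕜 := ℂ) x (R x))
    rw [smul_apply, norm_smul, hnε, one_mul]
    by_contra! hc
    have hpos : 0 < ‖R x‖ := by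
      by_contra! h0
      have : ‖R x‖ = 0 := le_antisymm h0 (norm_nonneg _)
      rw [this, mul_zero] at hc
      exact absurd hc (norm_nonneg x).not_gt
    nlinarith [sq_nonneg ‖star X (R x)‖, mul_lt_mul_of_pos_right hc hpos]
  · refine opNorm_le_bound _ zero_le_one fun x => ?_
    have h := key (R (X x))
    rw [hQR] at h
    have h1 : ⟪X x, R (X x)⟫_ℂ = ⟪x, star X (R (X x))⟫_ℂ := by
      rw [star_eq_adjoint, adjoint_inner_right]
    rw [h1] at h
    have h2 := norm_sub_sq (𝕜 := ℂ) x (star X (R (X x)))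
    rw [one_mul]
    change ‖x - star X (R (X x))‖ ≤ ‖x‖
    refine (sq_le_sq₀ (norm_nonneg _) (norm_nonneg _)).1 ?_
    rw [h2]
    change _ - 2 * (⟪x, star X (R (X x))⟫_ℂ).re + _ ≤ _
    rw [h]
    nlinarith [sq_nonneg ‖star X (R (X x))‖, mul_nonneg hε.le (sq_nonneg ‖R (X x)‖)]
  · rw [hXK]
    rw [← Real.le_sqrt (norm_nonneg _) hε.le]
    refine opNorm_le_bound _ (Real.sqrt_nonneg _) fun x => ?_
    have h := key (R (X x))
    rw [hQR] at h
    have h1 : ⟪X x, R (X x)⟫_ℂ = ⟪x, star X (R (X x))⟫_ℂ := by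
      rw [star_eq_adjoint, adjoint_inner_right]
    rw [h1] at h
    have h2 := (Complex.re_le_norm _).trans
      (norm_inner_le_norm (𝕜 := ℂ) x (star X (R (X x))))
    change ‖(ε : ℂ) • R (X x)‖ ≤ _
    rw [norm_smul, hnε]
    refine (sq_le_sq₀ (by positivity) (by positivity)).1 ?_
    rw [mul_pow, mul_pow, Real.sq_sqrt hε.le]
    have h3 : ε * ‖R (X x)‖ ^ 2 ≤ ‖x‖ ^ 2 := by
      nlinarith [sq_nonneg (‖x‖ - 2 * ‖star X (R (X x))‖), sq_nonneg ‖x‖]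
    nlinarith

theorem norm_mul_sq_le_norm_left {V S D : H →L[ℂ] H} (hS : star S = S) (hD : ‖D‖ ≤ 1) :
    ‖D * (V * S)‖ ^ 2 ≤ ‖D * (V * S * S)‖ * ‖V‖ := by
  have h : D * (V * S) * star (D * (V * S)) = D * (V * S * S) * (star V * star D) := by
    simp only [star_mul, hS, mul_assoc]
  rw [sq, ← CStarRing.norm_self_mul_star, h]
  refine (norm_mul_le _ _).trans (mul_le_mul_of_nonneg_left ?_ (norm_nonneg _))
  refine (norm_mul_le _ _).trans ?_
  rw [norm_star, norm_star]
  exact mul_le_of_le_one_right (norm_nonneg _) hD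

theorem norm_mul_sq_le_norm_right {S D : H →L[ℂ] H} (hS : star S = S) (hD : ‖D‖ ≤ 1) :
    ‖S * D‖ ^ 2 ≤ ‖S * S * D‖ := by
  have h : star (S * D) * (S * D) = star D * (S * S * D) := by
    simp only [star_mul, hS, mul_assoc]
  rw [sq, ← CStarRing.norm_star_mul_self, h]
  refine (norm_mul_le _ _).trans ?_
  rw [norm_star]
  exact mul_le_of_le_one_left (norm_nonneg _) hD

theorem tendsto_zero_of_sq_le {a b : ℕ → ℝ} (ha : ∀ n, 0 ≤ a n) (h : ∀ n, a n ^ 2 ≤ b n)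
    (hb : Tendsto b atTop (𝓝 0)) : Tendsto a atTop (𝓝 0) := by
  have h2 := (Real.continuous_sqrt.tendsto 0).comp hb
  rw [Real.sqrt_zero] at h2
  exact squeeze_zero ha (fun n => Real.le_sqrt_of_sq_le (h n)) h2

theorem tendsto_norm_mul_zero_left {A : ℕ → H →L[ℂ] H}
    (hA : Tendsto (fun n => ‖A n‖) atTop (𝓝 0)) (B : H →L[ℂ] H) :
    Tendsto (fun n => ‖B * A n‖) atTop (𝓝 0) :=
  squeeze_zero (fun _ => norm_nonneg _) (fun n => norm_mul_le B (A n))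
    (by simpa using hA.const_mul ‖B‖)

theorem tendsto_norm_mul_zero_right {A : ℕ → H →L[ℂ] H}
    (hA : Tendsto (fun n => ‖A n‖) atTop (𝓝 0)) (B : H →L[ℂ] H) :
    Tendsto (fun n => ‖A n * B‖) atTop (𝓝 0) :=
  squeeze_zero (fun _ => norm_nonneg _) (fun n => norm_mul_le (A n) B)
    (by simpa using hA.mul_const ‖B‖)

end TraceClass

/-- Cyclicity of the trace: for bounded operators `X, Y` on a separable Hilbert space such
that both `XY` and `YX` are trace class (the diagonal sum of `|XY| = √((XY)*(XY))`,
resp. of `|YX|`, in a Hilbert basis converges), `tr(XY) = tr(YX)`. -/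
theorem stmt_10 {H ι : Type*} [NormedAddCommGroup H] [InnerProductSpace ℂ H]
    [CompleteSpace H] (e : HilbertBasis ι ℂ H) (X Y : H →L[ℂ] H)
    (hXY : Summable fun k =>
      (⟪(e k : H), cfc Real.sqrt (star (X * Y) * (X * Y)) (e k)⟫_ℂ).re)
    (hYX : Summable fun k =>
      (⟪(e k : H), cfc Real.sqrt (star (Y * X) * (Y * X)) (e k)⟫_ℂ).re) :
    ∑' k, ⟪(e k : H), (X * Y) (e k)⟫_ℂ = ∑' k, ⟪(e k : H), (Y * X) (e k)⟫_ℂ := by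
  obtain ⟨V, S, hT, hS, hSHS, -⟩ := exists_polar_factorization e (X * Y) hXY
  obtain ⟨W, Z, hT', hZ, hZHS, hZn⟩ := exists_polar_factorization e (Y * X) hYX
  have hVS := hSHS.mul_left V
  have hWZ := hZHS.mul_left W
  choose K hK1 hK2 hK3 using fun n : ℕ =>
    exists_approx_inverse X (ε := 1 / ((n : ℝ) + 1)) (by positivity)
  have hDX : Tendsto (fun n => ‖(1 - X * K n) * X‖) atTop (𝓝 0) :=
    tendsto_zero_of_sq_le (fun _ => norm_nonneg _) hK3 tendsto_one_div_add_atTop_nhds_zero_nat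
  have hDX' (n : ℕ) : (1 - X * K n) * X = X * (1 - K n * X) := by noncomm_ring
  have lim1 : Tendsto (fun n => diagSum e ((1 - X * K n) * (X * Y))) atTop (𝓝 0) := by
    have hb : Tendsto (fun n => ‖(1 - X * K n) * (V * S)‖) atTop (𝓝 0) := by
      refine tendsto_zero_of_sq_le (fun _ => norm_nonneg _)
        (fun n => norm_mul_sq_le_norm_left hS (hK1 n)) ?_
      rw [← hT]
      simpa [mul_assoc] using (tendsto_norm_mul_zero_right hDX Y).mul_const ‖V‖
    refine (hVS.tendsto_diagSum_zero hSHS hK1 ?_).congr fun n => ?_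
    · simpa only [mul_assoc] using tendsto_norm_mul_zero_left hb S
    · rw [hT, ← mul_assoc _ (V * S) S, (hVS.mul_left _).diagSum_mul_comm hSHS, mul_assoc S]
  have lim2 : Tendsto (fun n => diagSum e (Y * X * (1 - K n * X))) atTop (𝓝 0) := by
    have hb : Tendsto (fun n => ‖Z * (1 - K n * X)‖) atTop (𝓝 0) := by
      refine tendsto_zero_of_sq_le (fun _ => norm_nonneg _)
        (fun n => (norm_mul_sq_le_norm_right hZ (hK2 n)).trans
          (opNorm_le_bound _ (norm_nonneg (Y * X * (1 - K n * X))) fun x => ?_)) ?_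
      · change ‖Z (Z ((1 - K n * X) x))‖ ≤ _
        rw [hZn]
        exact (Y * X * (1 - K n * X)).le_opNorm x
      · simp only [mul_assoc, ← hDX']
        exact tendsto_norm_mul_zero_left hDX Y
    refine (hWZ.tendsto_diagSum_zero hZHS hK2 (tendsto_norm_mul_zero_right hb _)).congr
      fun n => ?_
    rw [hT', mul_assoc _ Z, hWZ.diagSum_mul_comm (hZHS.mul_right _)]
  have split1 (n : ℕ) : diagSum e ((1 - X * K n) * (X * Y)) =
      diagSum e (X * Y) - diagSum e (X * K n * (X * Y)) := by
    have h1 := hVS.summable_diag hSHS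
    have h2 := (hVS.mul_left (X * K n)).summable_diag hSHS
    rw [mul_assoc (X * K n), ← hT] at h2
    rw [← hT] at h1
    simp only [diagSum, sub_mul, one_mul, sub_apply, inner_sub_right]
    exact h1.tsum_sub h2
  have split2 (n : ℕ) : diagSum e (Y * X * (1 - K n * X)) =
      diagSum e (Y * X) - diagSum e (Y * X * (K n * X)) := by
    have h1 := hWZ.summable_diag hZHS
    have h2 := hWZ.summable_diag (hZHS.mul_right (K n * X))
    rw [← mul_assoc, ← hT'] at h2
    rw [← hT'] at h1
    simp only [diagSum, mul_sub, mul_one, sub_apply, inner_sub_right]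
    exact h1.tsum_sub h2
  have cyc (n : ℕ) : diagSum e (X * K n * (X * Y)) = diagSum e (Y * X * (K n * X)) := by
    have h1 := hVS.diagSum_mul_comm_bounded hSHS (X * K n)
    rw [← hT] at h1
    have h2 := hWZ.diagSum_mul_comm_bounded (hZHS.mul_right (K n)) X
    rw [← mul_assoc (W * Z), ← hT'] at h2
    rw [h1]
    simpa only [mul_assoc] using h2
  have hlim := lim1.sub lim2
  simp only [split1, split2, cyc, sub_sub_sub_cancel_right, sub_zero] at hlim
  exact sub_eq_zero.1 (tendsto_nhds_unique tendsto_const_nhds hlim)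
end
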